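/- Fix s > 0 and b₀ ∈ ℝ, let f be the sigmoidal transform f(u) = d·(h·σ(s·(u+b₀)) − 1), and let I(x,y) = 1 − x + x·y be the Reichenbach implication likelihood. Then for every x ∈ ℝ and every y ∈ (0,1), the partial derivative with respect to x of the sigmoidal Reichenbach likelihood (x,y) ↦ f(I(x,y)) equals f′(I(x,y))·(y − 1) and is strictly negative; hence the sigmoidal Reichenbach implication likelihood is 1-implication biased. -/

import Mathlib

/-- For `s > 0`, `b₀ ∈ ℝ`, let `f` be the sigmoidal transform with (positive)
derivative `f'`, and `I(x,y) = 1 - x + x*y` the Reichenbach likelihood.  Then for every `x`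
and every `y ∈ (0,1)`, the sigmoidal Reichenbach likelihood `x ↦ f (I x y)` has partial
derivative `f'(I(x,y))·(y-1)` at `x`, which is strictly negative; hence the sigmoidal
Reichenbach implication likelihood is `1`-implication biased. -/
theorem stmt13 (s b₀ : ℝ) (hs : 0 < s)
    (σ : ℝ → ℝ) (hσ : ∀ t, σ t = 1 / (1 + Real.exp (-t)))
    (h d : ℝ) (hh : h = 1 + Real.exp (-b₀ * s))
    (hd : d = (1 + Real.exp (-s * (1 + b₀))) /
      (Real.exp (-b₀ * s) - Real.exp (-s * (1 + b₀))))
    (f : ℝ → ℝ) (hf : ∀ u, f u = d * (h * σ (s * (u + b₀)) - 1))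
    (f' : ℝ → ℝ)
    (hf' : ∀ u, f' u = d * h * s * σ (s * (u + b₀)) * (1 - σ (s * (u + b₀)))) :
    ∀ x : ℝ, ∀ y ∈ Set.Ioo (0:ℝ) 1,
      HasDerivAt (fun x' : ℝ => f (1 - x' + x' * y)) (f' (1 - x + x * y) * (y - 1)) x ∧
      f' (1 - x + x * y) * (y - 1) < 0 := by
  have σ_deriv (t : ℝ) : HasDerivAt σ (σ t * (1 - σ t)) t := by
    have hne : 1 + Real.exp (-t) ≠ 0 := by positivity
    have σ_eq : σ = fun u => (1 + Real.exp (-u))⁻¹ := by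
      funext u
      rw [hσ, one_div]
    rw [σ_eq]
    refine (((hasDerivAt_neg t).exp.const_add 1).fun_inv hne).congr_deriv ?_
    field_simp
    ring
  have σ_pos (t : ℝ) : 0 < σ t := by
    rw [hσ]
    positivity
  have σ_lt_one (t : ℝ) : σ t < 1 := by
    rw [hσ, div_lt_one (by positivity)]
    linarith [Real.exp_pos (-t)]
  have d_pos : 0 < d := by
    have hlt : Real.exp (-s * (1 + b₀)) < Real.exp (-b₀ * s) :=
      Real.exp_lt_exp.mpr (by linarith)
    rw [hd]
    exact div_pos (by positivity) (sub_pos.mpr hlt)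
  have h_pos : 0 < h := by
    rw [hh]
    positivity
  have f_deriv (u : ℝ) : HasDerivAt f (f' u) u := by
    have inner : HasDerivAt (fun v => s * (v + b₀)) s u := by
      simpa using ((hasDerivAt_id u).add_const b₀).const_mul s
    rw [funext hf, hf']
    refine ((((σ_deriv _).comp u inner).const_mul h).sub_const 1).const_mul d |>.congr_deriv ?_
    ring
  rintro x y ⟨-, hy⟩
  constructor
  · have inner : HasDerivAt (fun x' : ℝ => 1 - x' + x' * y) (y - 1) x := by
      refine (((hasDerivAt_id' x).const_sub 1).add
        ((hasDerivAt_id' x).mul_const y)).congr_deriv ?_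
      ring
    exact (f_deriv _).comp x inner
  · refine mul_neg_of_pos_of_neg ?_ (sub_neg.mpr hy)
    rw [hf']
    have := σ_pos (s * (1 - x + x * y + b₀))
    have := sub_pos.mpr (σ_lt_one (s * (1 - x + x * y + b₀)))
    positivity
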